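/- Let s ≥ 1 be an integer and A = {1, 2, 4s}. Then for every odd positive integer u one has P_A(2(36s²u³ − 6su − s − 1)) = P₄(9(4su² − 1)). -/

import Mathlib

/-- `partCount A n` is the number of partitions of `n` into parts from `A`. -/
def partCount (A : Finset ℕ) (n : ℕ) : ℕ :=
  ((Finset.univ : Finset (Nat.Partition n)).filter (fun p => ∀ i ∈ p.parts, i ∈ A)).card

/-- For `a ∉ A`, the partitions into `insert a A` without the part `a`
are the partitions into `A`. -/
theorem partCount_insert_filter_notMem {A : Finset ℕ} {a : ℕ} (haA : a ∉ A) (n : ℕ) :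
    (((Finset.univ : Finset (Nat.Partition n)).filter
      (fun p => ∀ i ∈ p.parts, i ∈ insert a A)).filter (fun p => a ∉ p.parts)).card =
      partCount A n := by
  unfold partCount
  congr 1
  ext p
  simp only [Finset.mem_filter, Finset.mem_univ, true_and, Finset.mem_insert]
  constructor
  · rintro ⟨h, ha⟩ i hi
    rcases h i hi with rfl | h
    · exact absurd hi ha
    · exact h
  · exact fun h => ⟨fun i hi => Or.inr (h i hi), fun ha => haA (h a ha)⟩

/-- Removing one part `a` from the partitions that contain it. -/
theorem partCount_filter_mem {B : Finset ℕ} {a : ℕ} (ha : 0 < a) (haB : a ∈ B) (n : ℕ) :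
    (((Finset.univ : Finset (Nat.Partition (n + a))).filter
      (fun p => ∀ i ∈ p.parts, i ∈ B)).filter (fun p => a ∈ p.parts)).card =
      partCount B n := by
  unfold partCount
  symm
  refine Finset.card_bij
    (fun p _ => ⟨a ::ₘ p.parts, ?_, ?_⟩) ?_ ?_ ?_
  · intro i hi
    rcases Multiset.mem_cons.1 hi with rfl | hi
    · exact ha
    · exact p.parts_pos hi
  · rw [Multiset.sum_cons, p.parts_sum, add_comm]
  · intro p hp
    simp only [Finset.mem_filter, Finset.mem_univ, true_and] at hp ⊢
    refine ⟨fun i hi => ?_, Multiset.mem_cons_self _ _⟩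
    rcases Multiset.mem_cons.1 hi with rfl | hi
    · exact haB
    · exact hp i hi
  · intro p _ q _ h
    ext1
    simpa using congrArg Nat.Partition.parts h
  · intro q hq
    simp only [Finset.mem_filter, Finset.mem_univ, true_and] at hq
    obtain ⟨hqB, hqa⟩ := hq
    have hsum : (q.parts.erase a).sum = n := by
      have h := q.parts_sum
      rw [← Multiset.cons_erase hqa, Multiset.sum_cons] at h
      omega
    refine ⟨⟨q.parts.erase a, fun hi => q.parts_pos (Multiset.mem_of_mem_erase hi), hsum⟩,
      ?_, ?_⟩
    · simp only [Finset.mem_filter, Finset.mem_univ, true_and]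
      exact fun i hi => hqB i (Multiset.mem_of_mem_erase hi)
    · ext1
      exact Multiset.cons_erase hqa

theorem partCount_insert_add {A : Finset ℕ} {a : ℕ} (ha : 0 < a) (haA : a ∉ A) (n : ℕ) :
    partCount (insert a A) (n + a) = partCount (insert a A) n + partCount A (n + a) := by
  rw [← partCount_filter_mem ha (Finset.mem_insert_self a A) n,
    ← partCount_insert_filter_notMem haA (n + a),
    Finset.card_filter_add_card_filter_not, partCount]

theorem partCount_insert_of_lt {A : Finset ℕ} {a n : ℕ} (haA : a ∉ A) (hn : n < a) :
    partCount (insert a A) n = partCount A n := by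
  rw [← partCount_insert_filter_notMem haA n, Finset.filter_true_of_mem, partCount]
  intro p _ hp
  have := Multiset.le_sum_of_mem hp
  rw [p.parts_sum] at this
  omega

theorem partCount_zero (A : Finset ℕ) : partCount A 0 = 1 := by
  unfold partCount
  rw [Finset.filter_true_of_mem]
  · simp
  · intro p _ i hi
    have h1 := Multiset.le_sum_of_mem hi
    have h2 := p.parts_pos hi
    rw [p.parts_sum] at h1
    omega

theorem partCount_empty {n : ℕ} (hn : 0 < n) : partCount ∅ n = 0 := by
  unfold partCount
  rw [Finset.card_eq_zero, Finset.filter_eq_empty_iff]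
  intro p _ h
  have hp : p.parts = 0 := Multiset.eq_zero_of_forall_notMem fun i hi => by simpa using h i hi
  have hs := p.parts_sum
  rw [hp, Multiset.sum_zero] at hs
  omega

theorem partCount_one (n : ℕ) : partCount {1} n = 1 := by
  induction n with
  | zero => exact partCount_zero _
  | succ n ih =>
    have h := partCount_insert_add (A := ∅) one_pos (by simp) n
    rw [insert_empty_eq, ih, partCount_empty (Nat.add_pos_right n one_pos)] at h
    exact h

theorem partCount_one_two (n : ℕ) : partCount {1, 2} n = n / 2 + 1 := by
  rw [Finset.pair_comm]
  induction n using Nat.twoStepInduction with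
  | zero => simp [partCount_zero]
  | one => rw [partCount_insert_of_lt (by simp) (by simp), partCount_one]
  | more n ih _ =>
    rw [partCount_insert_add two_pos (by simp), ih, partCount_one]
    omega

theorem partCount_one_two_three_add (n : ℕ) :
    partCount {1, 2, 3} (n + 3) = partCount {1, 2, 3} n + (n + 3) / 2 + 1 := by
  have h : ({1, 2, 3} : Finset ℕ) = insert 3 {1, 2} := by decide
  rw [h, partCount_insert_add (by simp) (by simp), partCount_one_two, add_assoc]

theorem partCount_one_two_three_of_lt {n : ℕ} (hn : n < 3) :
    partCount {1, 2, 3} n = n / 2 + 1 := by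
  have h : ({1, 2, 3} : Finset ℕ) = insert 3 {1, 2} := by decide
  rw [h, partCount_insert_of_lt (by simp) hn, partCount_one_two]

theorem partCount_one_two_three_add_six (n : ℕ) :
    partCount {1, 2, 3} (n + 6) = partCount {1, 2, 3} n + n + 6 := by
  have h1 := partCount_one_two_three_add n
  have h2 := partCount_one_two_three_add (n + 3)
  rw [add_assoc] at h2
  norm_num at h2
  omega

theorem partCount_one_two_three_six_mul_add (k r : ℕ) :
    partCount {1, 2, 3} (6 * k + r) = partCount {1, 2, 3} r + 3 * k ^ 2 + (r + 3) * k := by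
  induction k with
  | zero => simp
  | succ k ih =>
    rw [show 6 * (k + 1) + r = 6 * k + r + 6 by ring, partCount_one_two_three_add_six, ih]
    ring

theorem partCount_one_two_three_four_add (n : ℕ) :
    partCount {1, 2, 3, 4} (n + 4) = partCount {1, 2, 3, 4} n + partCount {1, 2, 3} (n + 4) := by
  have h : ({1, 2, 3, 4} : Finset ℕ) = insert 4 {1, 2, 3} := by decide
  rw [h, partCount_insert_add (by simp) (by simp)]

theorem partCount_one_two_three_four_twelve_mul_add_three (k : ℕ) :
    partCount {1, 2, 3, 4} (12 * k + 3) = 3 * (k + 1) * (2 * k + 1) ^ 2 := by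
  have h1 : partCount {1, 2, 3} 1 = 1 := partCount_one_two_three_of_lt (by simp)
  have h3 : partCount {1, 2, 3} 3 = 3 := by
    rw [partCount_one_two_three_add 0, partCount_zero]
  have h5 : partCount {1, 2, 3} 5 = 5 := by
    rw [partCount_one_two_three_add 2, partCount_one_two_three_of_lt (by simp)]
  induction k with
  | zero =>
    have h : ({1, 2, 3, 4} : Finset ℕ) = insert 4 {1, 2, 3} := by decide
    rw [h, partCount_insert_of_lt (by simp) (by simp)]
    simpa using h3
  | succ k ih =>
    rw [show 12 * (k + 1) + 3 = 12 * k + 3 + 4 + 4 + 4 by ring,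
      partCount_one_two_three_four_add, partCount_one_two_three_four_add,
      partCount_one_two_three_four_add, ih,
      show 12 * k + 3 + 4 + 4 + 4 = 6 * (2 * k + 2) + 3 by ring,
      show 12 * k + 3 + 4 + 4 = 6 * (2 * k + 1) + 5 by ring,
      show 12 * k + 3 + 4 = 6 * (2 * k + 1) + 1 by ring,
      partCount_one_two_three_six_mul_add, partCount_one_two_three_six_mul_add,
      partCount_one_two_three_six_mul_add, h1, h3, h5]
    ring

theorem partCount_one_two_four_mul {s : ℕ} (hs : 1 ≤ s) (m : ℕ) :
    partCount {1, 2, 4 * s} (4 * s * m + 2 * (s - 1)) = s * (m + 1) ^ 2 := by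
  have h : ({1, 2, 4 * s} : Finset ℕ) = insert (4 * s) {1, 2} := by
    ext i
    simp only [Finset.mem_insert, Finset.mem_singleton]
    tauto
  have hmem : 4 * s ∉ ({1, 2} : Finset ℕ) := by
    simp only [Finset.mem_insert, Finset.mem_singleton]
    omega
  rw [h]
  induction m with
  | zero =>
    rw [partCount_insert_of_lt hmem (by omega), partCount_one_two]
    simp only [mul_zero, zero_add, one_pow, mul_one]
    omega
  | succ m ih =>
    rw [show 4 * s * (m + 1) + 2 * (s - 1) = 4 * s * m + 2 * (s - 1) + 4 * s by ring,
      partCount_insert_add (by omega) hmem, ih, partCount_one_two]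
    obtain ⟨t, rfl⟩ := Nat.exists_eq_add_of_le' hs
    rw [show 4 * (t + 1) * m + 2 * (t + 1 - 1) + 4 * (t + 1) =
      2 * (2 * (t + 1) * m + t + 2 * (t + 1)) by rw [Nat.add_sub_cancel]; ring,
      Nat.mul_div_cancel_left _ two_pos]
    ring

theorem stmt15 (s : ℕ) (hs : 1 ≤ s) (u : ℕ) (hu : 0 < u) (hodd : Odd u) :
    partCount {1, 2, 4 * s} (2 * (36 * s ^ 2 * u ^ 3 - 6 * s * u - s - 1)) =
      partCount {1, 2, 3, 4} (9 * (4 * s * u ^ 2 - 1)) := by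
  obtain ⟨v, hv⟩ : ∃ v, s * u ^ 2 = v + 1 :=
    Nat.exists_eq_add_of_le' (Nat.mul_pos hs (pow_pos hu 2))
  obtain ⟨m, hm⟩ : ∃ m, 3 * u * (6 * v + 5) = m + 1 :=
    Nat.exists_eq_add_of_le' (show 0 < 3 * u * (6 * v + 5) by positivity)
  have hl : 2 * (36 * s ^ 2 * u ^ 3 - 6 * s * u - s - 1) = 4 * s * m + 2 * (s - 1) := by
    have e : 36 * s ^ 2 * u ^ 3 = 2 * (s * m) + 2 * s + 6 * s * u := by
      calc 36 * s ^ 2 * u ^ 3 = 36 * s * u * (s * u ^ 2) := by ring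
        _ = 2 * s * (3 * u * (6 * v + 5)) + 6 * s * u := by rw [hv]; ring
        _ = _ := by rw [hm]; ring
    rw [e, Nat.add_sub_cancel, mul_assoc 4 s m]
    omega
  have hr : 9 * (4 * s * u ^ 2 - 1) = 12 * (3 * v + 2) + 3 := by
    rw [mul_assoc, hv]
    omega
  rw [hl, hr, partCount_one_two_four_mul hs, partCount_one_two_three_four_twelve_mul_add_three,
    ← hm]
  calc s * (3 * u * (6 * v + 5)) ^ 2 = 9 * (s * u ^ 2) * (6 * v + 5) ^ 2 := by ring
    _ = _ := by rw [hv]; ring
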